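/- arXiv:2202.09495 — 4 statements merged into one kernel-verified Lean document; each statement's English description precedes it below -/
import Mathlib

section
/- Every single water-move can be simulated by ball-moves: if S ⇒ S' then S →* S'. Consequently, the reflexive-transitive closure of water-moves is contained in that of ball-moves: S ⇒* T implies S →* T. -/
open scoped Classical

noncomputable section

/-- A configuration: each bin holds a list of colors (bottom to top) of length at most `h`. -/
def Config {B C : Type*} (h : ℕ) (S : B → List C) : Prop := ∀ b, (S b).length ≤ h

/-- An initial configuration: every bin is full (length `h`) or empty. -/
def InitConfig {B C : Type*} (h : ℕ) (S : B → List C) : Prop :=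
  ∀ b, (S b).length = h ∨ (S b).length = 0

/-- A sorted (goal) configuration: every bin is empty or monochromatically full. -/
def SortedConfig {B C : Type*} (h : ℕ) (S : B → List C) : Prop :=
  ∀ b, S b = [] ∨ ∃ c, S b = List.replicate h c

/-- A ball-move from `S` to `S'`. -/
def BallMove {B C : Type*} (h : ℕ) (S S' : B → List C) : Prop :=
  ∃ b₁ b₂ c, b₁ ≠ b₂ ∧
    S b₁ = S' b₁ ++ [c] ∧
    (S b₂ = [] ∨ (S b₂).getLast? = some c) ∧
    S' b₂ = S b₂ ++ [c] ∧ (S' b₂).length ≤ h ∧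
    ∀ b, b ≠ b₁ → b ≠ b₂ → S' b = S b

/-- A water-move from `S` to `S'`. -/
def WaterMove {B C : Type*} (h : ℕ) (S S' : B → List C) : Prop :=
  ∃ b₁ b₂ c m, 1 ≤ m ∧ b₁ ≠ b₂ ∧
    S b₁ = S' b₁ ++ List.replicate m c ∧
    (S b₂ = [] ∨ (S b₂).getLast? = some c) ∧
    S' b₂ = S b₂ ++ List.replicate m c ∧ (S' b₂).length ≤ h ∧
    ((S' b₁).getLast? ≠ some c ∨ (S' b₂).length = h) ∧
    ∀ b, b ≠ b₁ → b ≠ b₂ → S' b = S b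

/-- `i` is a border of the list `α` (1-indexed): `i = 0`, or `1 ≤ i < |α|` and `α[i] ≠ α[i+1]`. -/
def IsBorder {C : Type*} (α : List C) (i : ℕ) : Prop :=
  i = 0 ∨ (1 ≤ i ∧ i < α.length ∧ α[i-1]? ≠ α[i]?)

/-- The set `D(α)` of borders of `α`. -/
def borders {C : Type*} (α : List C) : Finset ℕ :=
  (Finset.range (α.length + 1)).filter (IsBorder α)

/-- The top border `max D(α)` of a list. -/
def topBorder {C : Type*} (α : List C) : ℕ := (borders α).sup id

/-- The top-border table `τ_S` of a configuration. -/
def tbt {B C : Type*} (S : B → List C) : B → ℕ := fun b => topBorder (S b)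

/-- `F_c(τ)`: the number of units of color `c` above the borders of `τ` in `S₀`. -/
def Fcnt {B C : Type*} [Fintype B] (h : ℕ) (S₀ : B → List C) (τ : B → ℕ) (c : C) : ℕ :=
  ∑ b, ((Finset.Icc (τ b + 1) h).filter (fun i => (S₀ b)[i-1]? = some c)).card

/-- `B_ε(τ)`: the bins whose top border is `0`. -/
def Beps {B : Type*} [Fintype B] (τ : B → ℕ) : Finset B :=
  Finset.univ.filter (fun b => τ b = 0)

/-- `B_c(τ)`: the non-monochrome bins whose top color is `c` (determined from `S₀`). -/
def Bcol {B C : Type*} [Fintype B] (S₀ : B → List C) (τ : B → ℕ) (c : C) : Finset B :=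
  Finset.univ.filter (fun b => τ b ≠ 0 ∧ (S₀ b)[τ b]? = some c)

/-- `G_c(τ) = Σ_{b ∈ B_c(τ)} (h − τ(b))`. -/
def Gcnt {B C : Type*} [Fintype B] (h : ℕ) (S₀ : B → List C) (τ : B → ℕ) (c : C) : ℕ :=
  ∑ b ∈ Bcol S₀ τ c, (h - τ b)

/-- `M_c(τ) = max(0, ⌈(F_c(τ) − G_c(τ))/h⌉)`. -/
def Mcnt {B C : Type*} [Fintype B] (h : ℕ) (S₀ : B → List C) (τ : B → ℕ) (c : C) : ℕ :=
  (⌈((Fcnt h S₀ τ c : ℚ) - (Gcnt h S₀ τ c : ℚ)) / (h : ℚ)⌉).toNat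

/-- `M_c^b(τ) = max(0, ⌈(F_c(τ) − G_c(τ) + (h − τ(b)))/h⌉)`. -/
def McntB {B C : Type*} [Fintype B] (h : ℕ) (S₀ : B → List C) (τ : B → ℕ) (c : C) (b : B) : ℕ :=
  (⌈((Fcnt h S₀ τ c : ℚ) - (Gcnt h S₀ τ c : ℚ) + ((h : ℚ) - (τ b : ℚ))) / (h : ℚ)⌉).toNat

/-- A configuration `S` is consistent with `S₀`. -/
def Consistent {B C : Type*} [Fintype B] [Fintype C] (h : ℕ) (S₀ S : B → List C) : Prop :=
  ∑ c : C, Mcnt h S₀ (tbt S) c ≤ (Beps (tbt S)).card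

/-- `S` is tight (relative to `S₀`): for every color `c` there are exactly `M_c(τ_S)`
nonempty monochrome bins of color `c`. -/
def Tight {B C : Type*} [Fintype B] [Fintype C] (h : ℕ) (S₀ S : B → List C) : Prop :=
  ∀ c : C,
    (Finset.univ.filter (fun b => S b ≠ [] ∧ ∀ x ∈ S b, x = c)).card = Mcnt h S₀ (tbt S) c

/-- The move `τ ↝_b τ'` on top-border tables (relative to `S₀`). -/
def TBMove {B C : Type*} [Fintype B] [Fintype C] (h : ℕ) (S₀ : B → List C)
    (τ τ' : B → ℕ) (b : B) : Prop :=
  (∀ a, a ≠ b → τ a = τ' a) ∧ 0 < τ b ∧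
  τ' b = ((borders (S₀ b)).filter (fun i => i < τ b)).sup id ∧
  ∑ c : C, McntB h S₀ τ c b ≤ (Beps τ).card

/-- The move `τ ↝ τ'`: `τ ↝_b τ'` for some bin `b`. -/
def TBStep {B C : Type*} [Fintype B] [Fintype C] (h : ℕ) (S₀ : B → List C)
    (τ τ' : B → ℕ) : Prop :=
  ∃ b, TBMove h S₀ τ τ' b

end

/-- Moving `m` units of color `c` one at a time from `b₁` to `b₂`. -/
theorem reflTransGen_ballMove_of_replicate {B C : Type*} {h : ℕ} {S' : B → List C} {b₁ b₂ : B}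
    {c : C} (hne : b₁ ≠ b₂) (hlen : (S' b₂).length ≤ h) (m : ℕ) (S : B → List C)
    (hsrc : S b₁ = S' b₁ ++ List.replicate m c)
    (htop : S b₂ = [] ∨ (S b₂).getLast? = some c)
    (htgt : S' b₂ = S b₂ ++ List.replicate m c)
    (hrest : ∀ b, b ≠ b₁ → b ≠ b₂ → S' b = S b) :
    Relation.ReflTransGen (BallMove h) S S' := by
  induction m generalizing S with
  | zero =>
    have hSS' : S = S' := by
      funext b
      by_cases h₁ : b = b₁
      · subst h₁; simpa using hsrc
      by_cases h₂ : b = b₂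
      · subst h₂; simpa using htgt.symm
      exact (hrest b h₁ h₂).symm
    rw [hSS']
  | succ m ih =>
    let T : B → List C := Function.update
      (Function.update S b₁ (S' b₁ ++ List.replicate m c)) b₂ (S b₂ ++ [c])
    have hT₁ : T b₁ = S' b₁ ++ List.replicate m c := by simp [T, hne]
    have hT₂ : T b₂ = S b₂ ++ [c] := by simp [T]
    have hT : ∀ b, b ≠ b₁ → b ≠ b₂ → T b = S b := fun b h₁ h₂ => by simp [T, h₁, h₂]
    have htgt' : S' b₂ = T b₂ ++ List.replicate m c := by
      rw [htgt, hT₂, List.replicate_succ, List.append_assoc, List.singleton_append]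
    have hstep : BallMove h S T := by
      refine ⟨b₁, b₂, c, hne, ?_, htop, hT₂, ?_, hT⟩
      · rw [hsrc, hT₁, List.replicate_succ', List.append_assoc]
      · refine le_trans ?_ hlen
        rw [htgt', List.length_append]
        exact Nat.le_add_right _ _
    refine .head hstep (ih T hT₁ (.inr ?_) htgt' fun b h₁ h₂ => ?_)
    · simp [hT₂]
    · rw [hrest b h₁ h₂, hT b h₁ h₂]

theorem WaterMove.reflTransGen_ballMove {B C : Type*} {h : ℕ} {S S' : B → List C}
    (hS : WaterMove h S S') : Relation.ReflTransGen (BallMove h) S S' := by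
  obtain ⟨b₁, b₂, c, m, -, hne, hsrc, htop, htgt, hlen, -, hrest⟩ := hS
  exact reflTransGen_ballMove_of_replicate hne hlen m S hsrc htop htgt hrest

/-- every water-move can be simulated by ball-moves, and consequently
`⇒* ⊆ →*`. -/
theorem statement_0 {B C : Type*} [Fintype B] [Fintype C] (h : ℕ) (hh : 1 ≤ h) :
    (∀ S S' : B → List C, Config h S → WaterMove h S S' →
      Relation.ReflTransGen (BallMove h) S S') ∧
    (∀ S T : B → List C, Config h S → Relation.ReflTransGen (WaterMove h) S T →
      Relation.ReflTransGen (BallMove h) S T) := by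
  refine ⟨fun S S' _ hS => hS.reflTransGen_ballMove, fun S T _ hST => ?_⟩
  induction hST with
  | refl => exact .refl
  | tail _ hstep ih => exact ih.trans hstep.reflTransGen_ballMove
end

section
/- Ball-moves remove borders monotonically from top to bottom: if S →* T, then for every bin b, the set of borders of T b equals { i ∈ D(S b) : i ≤ τ_T(b) }, where τ_T is the top-border table of T. -/
open scoped Classical

theorem mem_borders {C : Type*} {α : List C} {i : ℕ} : i ∈ borders α ↔ IsBorder α i := by
  simp only [borders, Finset.mem_filter, Finset.mem_range, IsBorder]
  grind

theorem isBorder_iff_append {C : Type*} (α β : List C) (i : ℕ) :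
    IsBorder α i ↔ IsBorder (α ++ β) i ∧ (i = 0 ∨ i < α.length) := by
  by_cases hi : i < α.length
  · have hi' : i - 1 < α.length := by omega
    simp only [IsBorder, List.getElem?_append_left hi, List.getElem?_append_left hi',
      List.length_append]
    constructor <;> intro H <;> grind
  · simp only [IsBorder]
    grind

theorem borders_append_singleton {C : Type*} {α : List C} {c : C}
    (hα : α = [] ∨ α.getLast? = some c) : borders (α ++ [c]) = borders α := by
  ext i
  rw [mem_borders, mem_borders, isBorder_iff_append α [c] i]
  refine ⟨fun hi => ⟨hi, ?_⟩, And.left⟩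
  rcases hi with hi | ⟨h1, h2, h3⟩
  · exact Or.inl hi
  · by_contra! hlt
    have hlen : i = α.length := by simp at h2; omega
    subst hlen
    rcases hα with rfl | hα
    · simp at h1
    · apply h3
      rw [List.getLast?_eq_getElem?] at hα
      rw [List.getElem?_append_left (by omega), hα]
      simp

/-- A set of naturals is an initial segment of another one. -/
def IsInitialSegment (s t : Finset ℕ) : Prop :=
  s ⊆ t ∧ ∀ i ∈ t, ∀ j ∈ s, i ≤ j → i ∈ s

theorem IsInitialSegment.refl (s : Finset ℕ) : IsInitialSegment s s :=
  ⟨Finset.Subset.refl s, fun _ hi _ _ _ => hi⟩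

theorem IsInitialSegment.trans {s t u : Finset ℕ} (hst : IsInitialSegment s t)
    (htu : IsInitialSegment t u) : IsInitialSegment s u :=
  ⟨hst.1.trans htu.1, fun i hi j hj hij =>
    hst.2 i (htu.2 i hi j (hst.1 hj) hij) j hj hij⟩

theorem isInitialSegment_borders_append {C : Type*} (α β : List C) :
    IsInitialSegment (borders α) (borders (α ++ β)) := by
  refine ⟨fun i hi => ?_, fun i hi j hj hij => ?_⟩
  · rw [mem_borders] at hi ⊢
    exact ((isBorder_iff_append α β i).1 hi).1
  · rw [mem_borders] at hi hj ⊢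
    refine (isBorder_iff_append α β i).2 ⟨hi, ?_⟩
    have := ((isBorder_iff_append α β j).1 hj).2
    omega

theorem BallMove.isInitialSegment_borders {B C : Type*} {h : ℕ} {S S' : B → List C}
    (hm : BallMove h S S') (b : B) : IsInitialSegment (borders (S' b)) (borders (S b)) := by
  obtain ⟨b₁, b₂, c, -, h₁, htop, h₂, -, hrest⟩ := hm
  by_cases hb₁ : b = b₁
  · subst hb₁
    rw [h₁]
    exact isInitialSegment_borders_append _ _
  · by_cases hb₂ : b = b₂
    · subst hb₂
      rw [h₂, borders_append_singleton htop]
      exact .refl _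
    · rw [hrest b hb₁ hb₂]
      exact .refl _

theorem topBorder_mem_borders {C : Type*} (α : List C) : topBorder α ∈ borders α := by
  have hne : (borders α).Nonempty := ⟨0, mem_borders.2 (Or.inl rfl)⟩
  obtain ⟨i, hi, hsup⟩ := Finset.exists_mem_eq_sup (borders α) hne id
  rw [topBorder, hsup]
  exact hi

theorem le_topBorder {C : Type*} {α : List C} {i : ℕ} (hi : i ∈ borders α) : i ≤ topBorder α :=
  Finset.le_sup (f := id) hi

/-- ball-moves remove borders monotonically from top to bottom. -/
theorem statement_1 {B C : Type*} [Fintype B] [Fintype C] (h : ℕ) (hh : 1 ≤ h)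
    (S T : B → List C) (hS : Config h S)
    (hST : Relation.ReflTransGen (BallMove h) S T) (b : B) :
    borders (T b) = (borders (S b)).filter (fun i => i ≤ tbt T b) := by
  have key : IsInitialSegment (borders (T b)) (borders (S b)) := by
    induction hST with
    | refl => exact .refl _
    | tail _ hm ih => exact (hm.isInitialSegment_borders b).trans ih
  ext i
  rw [Finset.mem_filter]
  exact ⟨fun hi => ⟨key.1 hi, le_topBorder hi⟩,
    fun hi => key.2 i hi.1 _ (topBorder_mem_borders (T b)) hi.2⟩
end

section
/- The contents below the top borders do not change under ball-moves: if S →* T, then for every bin b and every index i with 1 ≤ i ≤ τ_T(b), (T b)[i] = (S b)[i], where τ_T is the top-border table of T. -/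
open scoped Classical

theorem topBorder_le_of_forall_isBorder {C : Type*} {α β : List C}
    (hαβ : ∀ i, IsBorder α i → IsBorder β i) : topBorder α ≤ topBorder β := by
  refine Finset.sup_le fun i hi => ?_
  have hβ : IsBorder β i := hαβ i (Finset.mem_filter.1 hi).2
  refine Finset.le_sup (f := id) (Finset.mem_filter.2 ⟨Finset.mem_range.2 ?_, hβ⟩)
  rcases hβ with rfl | ⟨-, hlt, -⟩ <;> omega

theorem topBorder_le_length {C : Type*} (α : List C) : topBorder α ≤ α.length :=
  Nat.lt_succ_iff.1 (Finset.mem_range.1 (Finset.mem_filter.1 (topBorder_mem_borders α)).1)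

theorem IsBorder.append_singleton {C : Type*} {α : List C} {i : ℕ} (hi : IsBorder α i) (c : C) :
    IsBorder (α ++ [c]) i := by
  rcases hi with rfl | ⟨h1, hlt, hne⟩
  · exact Or.inl rfl
  · refine Or.inr ⟨h1, by simp; omega, ?_⟩
    rwa [List.getElem?_append_left (by omega), List.getElem?_append_left hlt]

theorem IsBorder.of_append_singleton {C : Type*} {α : List C} {c : C} {i : ℕ}
    (hc : α = [] ∨ α.getLast? = some c) (hi : IsBorder (α ++ [c]) i) : IsBorder α i := by
  rcases hi with rfl | ⟨h1, hlt, hne⟩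
  · exact Or.inl rfl
  · simp only [List.length_append, List.length_singleton] at hlt
    rw [List.getElem?_append_left (by omega)] at hne
    rcases Nat.lt_succ_iff_lt_or_eq.1 hlt with hlt | rfl
    · exact Or.inr ⟨h1, hlt, by rwa [List.getElem?_append_left hlt] at hne⟩
    · rcases hc with rfl | hc
      · simp at h1
      · rw [List.getLast?_eq_getElem?] at hc
        simp [hc] at hne

/-- A ball-move does not raise any top border, and it preserves the contents below the
new top borders. -/
theorem BallMove.topBorder_le_and_getElem?_eq {B C : Type*} {h : ℕ} {S T : B → List C}
    (hST : BallMove h S T) (b : B) :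
    topBorder (T b) ≤ topBorder (S b) ∧ ∀ i < topBorder (T b), (T b)[i]? = (S b)[i]? := by
  obtain ⟨b₁, b₂, c, -, hS, hc, hT, -, heq⟩ := hST
  by_cases hb₁ : b = b₁
  · subst hb₁
    rw [hS]
    refine ⟨topBorder_le_of_forall_isBorder fun i hi => hi.append_singleton c, fun i hi => ?_⟩
    rw [List.getElem?_append_left (hi.trans_le (topBorder_le_length _))]
  by_cases hb₂ : b = b₂
  · subst hb₂
    rw [hT]
    have hle : topBorder (S b ++ [c]) ≤ topBorder (S b) :=
      topBorder_le_of_forall_isBorder fun i hi => hi.of_append_singleton hc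
    refine ⟨hle, fun i hi => ?_⟩
    rw [List.getElem?_append_left ((hi.trans_le hle).trans_le (topBorder_le_length _))]
  simp [heq b hb₁ hb₂]

/-- the contents below the top borders do not change under ball-moves. -/
theorem statement_2 {B C : Type*} [Fintype B] [Fintype C] (h : ℕ) (hh : 1 ≤ h)
    (S T : B → List C) (hS : Config h S)
    (hST : Relation.ReflTransGen (BallMove h) S T) (b : B) :
    ∀ i, 1 ≤ i → i ≤ tbt T b → (T b)[i-1]? = (S b)[i-1]? := by
  induction hST with
  | refl => intros; rfl
  | tail _ hmove ih =>
    intro i h1 hi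
    obtain ⟨hle, hcontents⟩ := hmove.topBorder_le_and_getElem?_eq b
    have hi' : i ≤ topBorder _ := hi
    exact (hcontents (i - 1) (by omega)).trans (ih i h1 (hi'.trans hle))
end

section
/- Equivalence of the ball sort puzzle and the water sort puzzle: an initial configuration S₀ can reach a sorted configuration by ball-moves if and only if it can reach a sorted configuration by water-moves, i.e., (∃ T sorted, S₀ →* T) ↔ (∃ T sorted, S₀ ⇒* T). -/
open scoped Classical

open Relation

/-! ### Splitting off the top segment of a bin -/

/-- The part of a list below its maximal monochromatic top segment. -/
noncomputable def lowerPart {C : Type*} (u : List C) : List C :=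
  u.rdropWhile (fun x => decide (u.getLast? = some x))

/-- `none` for monochromatic (possibly empty) lists; otherwise the part below the top segment
together with the top color. -/
noncomputable def frame {C : Type*} (u : List C) : Option (List C × C) :=
  if lowerPart u = [] then none else u.getLast?.map (fun c => (lowerPart u, c))

section Frame

variable {C : Type*}

lemma getLast?_append_replicate (l : List C) (k : ℕ) (c : C) :
    (l ++ List.replicate (k + 1) c).getLast? = some c := by
  rw [List.replicate_succ', ← List.append_assoc]
  simp

lemma exists_top_segment (u : List C) :
    u = [] ∨ ∃ l k c, l.getLast? ≠ some c ∧ u = l ++ List.replicate (k + 1) c := by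
  induction u using List.reverseRecOn with
  | nil => exact Or.inl rfl
  | append_singleton u a ih =>
    right
    by_cases hu : u.getLast? = some a
    · rcases ih with rfl | ⟨l, k, c, hl, rfl⟩
      · simp at hu
      · rw [getLast?_append_replicate] at hu
        obtain rfl : c = a := by simpa using hu
        refine ⟨l, k + 1, c, hl, ?_⟩
        rw [List.append_assoc, ← List.replicate_succ']
    · exact ⟨u, 0, a, hu, by simp⟩

lemma lowerPart_append_replicate {l : List C} {c : C} (hl : l.getLast? ≠ some c) (k : ℕ) :
    lowerPart (l ++ List.replicate (k + 1) c) = l := by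
  unfold lowerPart
  rw [getLast?_append_replicate]
  generalize k + 1 = n
  induction n with
  | zero =>
    induction l using List.reverseRecOn with
    | nil => simp
    | append_singleton l a _ =>
      simp only [List.replicate_zero, List.append_nil]
      rw [List.rdropWhile_concat_neg]
      simp at hl ⊢
      exact fun h => hl h.symm
  | succ n ih =>
    rw [List.replicate_succ', ← List.append_assoc, List.rdropWhile_concat_pos _ _ _ (by simp)]
    exact ih

lemma frame_append_replicate {l : List C} {c : C} (hne : l ≠ []) (hl : l.getLast? ≠ some c)
    (k : ℕ) : frame (l ++ List.replicate (k + 1) c) = some (l, c) := by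
  unfold frame
  rw [lowerPart_append_replicate hl, if_neg hne, getLast?_append_replicate]
  rfl

lemma frame_nil : frame ([] : List C) = none := by simp [frame, lowerPart]

lemma frame_replicate (k : ℕ) (c : C) : frame (List.replicate k c) = none := by
  cases k with
  | zero => exact frame_nil
  | succ k =>
    have := lowerPart_append_replicate (l := []) (c := c) (by simp) k
    rw [List.nil_append] at this
    simp [frame, this]

lemma eq_of_frame_eq_none {u : List C} (hu : frame u = none) :
    u = [] ∨ ∃ k c, u = List.replicate (k + 1) c := by
  rcases exists_top_segment u with rfl | ⟨l, k, c, hl, rfl⟩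
  · exact Or.inl rfl
  · by_cases hne : l = []
    · subst hne
      exact Or.inr ⟨k, c, by simp⟩
    · simp [frame_append_replicate hne hl] at hu

lemma eq_replicate_of_frame_eq_none {u : List C} {d : C} (hu : frame u = none)
    (ht : u.getLast? = some d) : ∃ k, u = List.replicate (k + 1) d := by
  rcases eq_of_frame_eq_none hu with rfl | ⟨k, c, rfl⟩
  · simp at ht
  · have := getLast?_append_replicate [] k c
    rw [List.nil_append, ht] at this
    obtain rfl : d = c := by simpa using this
    exact ⟨k, rfl⟩

lemma eq_of_frame_eq_some {u l : List C} {c : C} (hu : frame u = some (l, c)) :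
    l ≠ [] ∧ l.getLast? ≠ some c ∧ ∃ k, u = l ++ List.replicate (k + 1) c := by
  rcases exists_top_segment u with rfl | ⟨l', k, c', hl, rfl⟩
  · simp [frame_nil] at hu
  · by_cases hne : l' = []
    · subst hne
      rw [List.nil_append, frame_replicate] at hu
      simp at hu
    · rw [frame_append_replicate hne hl] at hu
      simp only [Option.some.injEq, Prod.mk.injEq] at hu
      obtain ⟨rfl, rfl⟩ := hu
      exact ⟨hne, hl, k, rfl⟩

/-- Pouring `c` onto a list that is empty or has top color `c` does not change its frame. -/
lemma frame_append_replicate_of_top {u : List C} {c : C} (hu : u = [] ∨ u.getLast? = some c)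
    (m : ℕ) : frame (u ++ List.replicate m c) = frame u := by
  rcases exists_top_segment u with rfl | ⟨l, k, c', hl, rfl⟩
  · rw [List.nil_append, frame_replicate, frame_nil]
  · rw [getLast?_append_replicate] at hu
    obtain rfl : c' = c := by simpa using hu
    rw [List.append_assoc, List.replicate_append_replicate, add_right_comm]
    by_cases hne : l = []
    · subst hne
      simp only [List.nil_append, frame_replicate]
    · rw [frame_append_replicate hne hl, frame_append_replicate hne hl]

lemma count_of_frame_eq_none {u : List C} (hu : frame u = none) (d : C) :
    u.count d = if u.getLast? = some d then u.length else 0 := by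
  rcases eq_of_frame_eq_none hu with rfl | ⟨k, c, rfl⟩
  · simp
  · have := getLast?_append_replicate [] k c
    rw [List.nil_append] at this
    rw [this, List.count_replicate]
    simp

/-- For a fixed non-monochromatic frame, a bin filled to the brim maximizes the count of every
color. -/
lemma count_le_count_of_frame_eq {h : ℕ} {u v : List C} (huv : frame u = frame v)
    (hne : frame u ≠ none) {d : C} (hu : u.getLast? = some d → u.length = h)
    (hv : v.length ≤ h) : v.count d ≤ u.count d := by
  obtain ⟨⟨l, c⟩, hf⟩ := Option.ne_none_iff_exists'.mp hne
  obtain ⟨-, -, k, rfl⟩ := eq_of_frame_eq_some hf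
  obtain ⟨-, -, j, rfl⟩ := eq_of_frame_eq_some (huv ▸ hf)
  rw [getLast?_append_replicate] at hu
  simp only [List.count_append, List.count_replicate, List.length_append, List.length_replicate,
    Option.some.injEq, beq_iff_eq] at hu hv ⊢
  by_cases hcd : c = d
  · have := hu hcd
    simp only [hcd, if_true]
    omega
  · simp [hcd]

end Frame

/-! ### Invariants of moves -/

section Moves

variable {B C : Type*}

lemma sum_add_pair_of_eq_off [Fintype B] {F G : B → ℕ} {x y : B} (hxy : x ≠ y)
    (hFG : ∀ b, b ≠ x → b ≠ y → G b = F b) :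
    ∑ b, G b + (F x + F y) = ∑ b, F b + (G x + G y) := by
  have key : ∀ K : B → ℕ,
      ∑ b, K b = K x + (K y + ∑ b ∈ (Finset.univ.erase x).erase y, K b) := fun K => by
    rw [Finset.add_sum_erase _ _ (by simp [hxy.symm]), Finset.add_sum_erase _ _ (by simp)]
  have hrest : ∑ b ∈ (Finset.univ.erase x).erase y, G b =
      ∑ b ∈ (Finset.univ.erase x).erase y, F b :=
    Finset.sum_congr rfl fun b hb => by
      simp only [Finset.mem_erase, Finset.mem_univ, and_true] at hb
      exact hFG b hb.2 hb.1
  rw [key F, key G, hrest]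
  omega

lemma BallMove.config {h : ℕ} {S S' : B → List C} (hm : BallMove h S S') (hS : Config h S) :
    Config h S' := by
  obtain ⟨b₁, b₂, c, -, h1, -, -, h4, h5⟩ := hm
  intro b
  by_cases hb2 : b = b₂
  · exact hb2 ▸ h4
  by_cases hb1 : b = b₁
  · have := hS b₁
    rw [h1, List.length_append] at this
    rw [hb1]
    omega
  · rw [h5 b hb1 hb2]
    exact hS b

lemma BallMove.sum_count [Fintype B] {h : ℕ} {S S' : B → List C} (hm : BallMove h S S')
    (d : C) : ∑ b, (S' b).count d = ∑ b, (S b).count d := by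
  obtain ⟨b₁, b₂, c, hne, h1, -, h3, -, h5⟩ := hm
  have := sum_add_pair_of_eq_off (F := fun b => (S b).count d) (G := fun b => (S' b).count d) hne
    (fun b hb1 hb2 => by rw [h5 b hb1 hb2])
  simp only [h1, h3, List.count_append] at this
  omega

lemma ballMoves_invariant [Fintype B] {h : ℕ} {S T : B → List C} (hS : Config h S)
    (hr : ReflTransGen (BallMove h) S T) :
    Config h T ∧ ∀ d, ∑ b, (T b).count d = ∑ b, (S b).count d := by
  induction hr with
  | refl => exact ⟨hS, fun _ => rfl⟩
  | tail _ hm ih => exact ⟨hm.config ih.1, fun d => (hm.sum_count d).trans (ih.2 d)⟩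

/-- A water-move is a sequence of ball-moves. -/
lemma WaterMove.ballMoves {h : ℕ} {S S' : B → List C} (hm : WaterMove h S S') :
    ReflTransGen (BallMove h) S S' := by
  obtain ⟨b₁, b₂, c, m, -, hne, h1, h2, h3, h4, -, h5⟩ := hm
  induction m generalizing S with
  | zero =>
    have : S = S' := by
      funext b
      by_cases hb1 : b = b₁
      · simpa [hb1] using h1
      by_cases hb2 : b = b₂
      · simpa [hb2] using h3.symm
      · exact (h5 b hb1 hb2).symm
    rw [this]
  | succ m ih =>
    let U := Function.update (Function.update S b₁ (S' b₁ ++ List.replicate m c)) b₂ (S b₂ ++ [c])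
    have hU1 : U b₁ = S' b₁ ++ List.replicate m c := by simp [U, hne]
    have hU2 : U b₂ = S b₂ ++ [c] := by simp [U]
    have hU : ∀ b, b ≠ b₁ → b ≠ b₂ → U b = S b := fun b hb1 hb2 => by simp [U, hb1, hb2]
    refine ReflTransGen.head (b := U) ⟨b₁, b₂, c, hne, ?_, h2, hU2, ?_, hU⟩ (ih ?_ ?_ ?_ ?_)
    · rw [hU1, h1, List.append_assoc, ← List.replicate_succ']
    · rw [hU2]
      simp only [h3, List.length_append, List.length_replicate] at h4
      simp only [List.length_append, List.length_singleton]
      omega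
    · exact hU1
    · simp [hU2]
    · rw [hU2, h3, List.append_assoc, List.singleton_append, List.replicate_succ]
    · intro b hb1 hb2
      rw [hU b hb1 hb2, h5 b hb1 hb2]

lemma ballMoves_of_waterMoves {h : ℕ} {S T : B → List C}
    (hr : ReflTransGen (WaterMove h) S T) : ReflTransGen (BallMove h) S T := by
  induction hr with
  | refl => exact .refl
  | tail _ hm ih => exact ih.trans hm.ballMoves

/-- Pouring as much as possible of the top segment of `x` onto `y`. -/
lemma exists_waterMove {h : ℕ} {V : B → List C} {x y : B} {l : List C} {k : ℕ} {c : C}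
    (hxy : x ≠ y) (hx : V x = l ++ List.replicate (k + 1) c) (hl : l.getLast? ≠ some c)
    (hy : V y = [] ∨ (V y).getLast? = some c) (hlt : (V y).length < h) :
    ∃ m V', WaterMove h V V' ∧ 1 ≤ m ∧ m ≤ k + 1 ∧ (V y).length + m ≤ h ∧
      (m = k + 1 ∨ (V y).length + m = h) ∧
      V' x = l ++ List.replicate (k + 1 - m) c ∧ V' y = V y ++ List.replicate m c ∧
      ∀ b, b ≠ x → b ≠ y → V' b = V b := by
  let m := min (k + 1) (h - (V y).length)
  let V' := Function.update (Function.update V x (l ++ List.replicate (k + 1 - m) c)) y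
    (V y ++ List.replicate m c)
  have h1 : V' x = l ++ List.replicate (k + 1 - m) c := by simp [V', hxy]
  have h2 : V' y = V y ++ List.replicate m c := by simp [V']
  have h3 : ∀ b, b ≠ x → b ≠ y → V' b = V b := fun b hb1 hb2 => by simp [V', hb1, hb2]
  refine ⟨m, V', ⟨x, y, c, m, by omega, hxy, ?_, hy, h2, ?_, ?_, h3⟩, by omega, by omega,
    by omega, by omega, h1, h2, h3⟩
  · rw [h1, hx, List.append_assoc, List.replicate_append_replicate]
    congr 2
    omega
  · rw [h2, List.length_append, List.length_replicate]
    omega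
  · by_cases hm : m = k + 1
    · left
      simpa [h1, hm] using hl
    · right
      rw [h2, List.length_append, List.length_replicate]
      omega

end Moves

/-! ### Consolidating water -/

section Consolidate

variable {B C : Type*} [Fintype B]

/-- The contribution of one bin to `potential`. -/
noncomputable def binPotential (h : ℕ) (src : Prop) (u : List C) : ℕ :=
  if src then 4 * u.length
  else if frame u = none then 2 * u.length + if 0 < u.length ∧ u.length < h then 1 else 0
  else 0

/-- A quantity that decreases when water is poured out of the bins in `src`, from monochromatic
bins onto non-monochromatic ones, or between partially filled monochromatic bins. -/
noncomputable def potential (h : ℕ) (src : B → Prop) (V : B → List C) : ℕ :=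
  ∑ b, binPotential h (src b) (V b)

/-- No frame-preserving water-move decreases the potential. -/
def Consolidated (h : ℕ) (src : B → Prop) (V : B → List C) : Prop :=
  ∀ V', WaterMove h V V' → (∀ b, frame (V' b) = frame (V b)) →
    potential h src V ≤ potential h src V'

lemma exists_consolidated (h : ℕ) (src : B → Prop) (W : B → List C) :
    ∃ V, ReflTransGen (WaterMove h) W V ∧ (∀ b, frame (V b) = frame (W b)) ∧
      Consolidated h src V := by
  induction hn : potential h src W using Nat.strong_induction_on generalizing W with
  | _ n ih =>
    by_cases hW : Consolidated h src W
    · exact ⟨W, .refl, fun _ => rfl, hW⟩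
    · unfold Consolidated at hW
      push Not at hW
      obtain ⟨W', hm, hf, hlt⟩ := hW
      obtain ⟨V, hr, hfV, hV⟩ := ih _ (hn ▸ hlt) W' rfl
      exact ⟨V, .head hm hr, fun b => (hfV b).trans (hf b), hV⟩

/-- In a consolidated configuration, pouring from `x` onto `y` either empties the top segment of a
non-monochromatic `x` or does not decrease the potential of the pair. -/
lemma Consolidated.pour {h : ℕ} {src : B → Prop} {V : B → List C} (hV : Consolidated h src V)
    {x y : B} {l : List C} {k : ℕ} {c : C}
    (hxy : x ≠ y) (hx : V x = l ++ List.replicate (k + 1) c) (hl : l.getLast? ≠ some c)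
    (hy : V y = [] ∨ (V y).getLast? = some c) (hlt : (V y).length < h) :
    (l ≠ [] ∧ ∃ V', WaterMove h V V' ∧ V' x = l ∧ ∀ b, b ≠ x → frame (V' b) = frame (V b)) ∨
    ∃ (m : ℕ) (u v : List C), 1 ≤ m ∧ m ≤ k + 1 ∧ (V y).length + m ≤ h ∧
      (m = k + 1 ∨ (V y).length + m = h) ∧
      u.length + m = (V x).length ∧ v.length = (V y).length + m ∧
      frame u = frame (V x) ∧ frame v = frame (V y) ∧
      binPotential h (src x) (V x) + binPotential h (src y) (V y) ≤
        binPotential h (src x) u + binPotential h (src y) v := by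
  obtain ⟨m, V', hm, hm1, hmk, hmh, hor, hx', hy', hrest⟩ := exists_waterMove hxy hx hl hy hlt
  have hfy : frame (V' y) = frame (V y) := by rw [hy', frame_append_replicate_of_top hy]
  have hfb : ∀ b, b ≠ x → frame (V' b) = frame (V b) := fun b hb => by
    by_cases hby : b = y
    · rw [hby, hfy]
    · rw [hrest b hb hby]
  by_cases hcase : l ≠ [] ∧ m = k + 1
  · exact Or.inl ⟨hcase.1, V', hm, by simp [hx', hcase.2], hfb⟩
  right
  have hsplit : V x = V' x ++ List.replicate m c := by
    rw [hx', hx, List.append_assoc, List.replicate_append_replicate]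
    congr 2
    omega
  have htop : V' x = [] ∨ (V' x).getLast? = some c := by
    by_cases hmk' : m = k + 1
    · left
      have : l = [] := by
        by_contra hne
        exact hcase ⟨hne, hmk'⟩
      simp [hx', this, hmk']
    · right
      obtain ⟨j, hj⟩ : ∃ j, k + 1 - m = j + 1 := ⟨k - m, by omega⟩
      rw [hx', hj, getLast?_append_replicate]
  have hfx : frame (V' x) = frame (V x) := by rw [hsplit, frame_append_replicate_of_top htop]
  have hle := hV V' hm fun b => by
    by_cases hb : b = x
    · rw [hb, hfx]
    · exact hfb b hb
  have hsum := sum_add_pair_of_eq_off (F := fun b => binPotential h (src b) (V b))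
    (G := fun b => binPotential h (src b) (V' b)) hxy (fun b hb1 hb2 => by rw [hrest b hb1 hb2])
  refine ⟨m, V' x, V' y, hm1, hmk, hmh, hor, ?_, ?_, hfx, hfy, ?_⟩
  · rw [hsplit]; simp
  · rw [hy']; simp
  · unfold potential at hle
    omega

/-- A monochromatic bin of color `c` coexists only with full non-monochromatic bins of top
color `c`. -/
lemma Consolidated.full_of_frame_ne_none {h : ℕ} {src : B → Prop} {V : B → List C}
    (hV : Consolidated h src V) (hcfg : Config h V) {x y : B} {k : ℕ} {c : C}
    (hsx : ¬ src x) (hsy : ¬ src y) (hx : V x = List.replicate (k + 1) c)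
    (hfy : frame (V y) ≠ none) (hy : (V y).getLast? = some c) : (V y).length = h := by
  by_contra hne
  have hlt : (V y).length < h := lt_of_le_of_ne (hcfg y) hne
  have hfx : frame (V x) = none := by rw [hx, frame_replicate]
  have hxy : x ≠ y := fun he => hfy (he ▸ hfx)
  rcases hV.pour (l := []) hxy (by simpa using hx) (by simp) (Or.inr hy) hlt with
    ⟨h0, -⟩ | ⟨m, u, v, hm1, -, -, -, hu, hv, hfu, hfv, hle⟩
  · exact h0 rfl
  · simp only [binPotential, if_neg hsx, if_neg hsy, hfu, hfv, hfx, if_neg hfy, if_true] at hle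
    split_ifs at hle <;> omega

/-- There is at most one partially filled monochromatic bin of each color. -/
lemma Consolidated.full_or_full {h : ℕ} {src : B → Prop} {V : B → List C}
    (hV : Consolidated h src V) (hcfg : Config h V) {x y : B} {k j : ℕ} {c : C}
    (hxy : x ≠ y) (hsx : ¬ src x) (hsy : ¬ src y) (hx : V x = List.replicate (k + 1) c)
    (hy : V y = List.replicate (j + 1) c) : (V x).length = h ∨ (V y).length = h := by
  by_contra! hne
  have hltx : (V x).length < h := lt_of_le_of_ne (hcfg x) hne.1
  have hlty : (V y).length < h := lt_of_le_of_ne (hcfg y) hne.2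
  have hfx : frame (V x) = none := by rw [hx, frame_replicate]
  have hfy : frame (V y) = none := by rw [hy, frame_replicate]
  have htop : (V y).getLast? = some c := by
    simpa [hy] using getLast?_append_replicate [] j c
  have hlx : (V x).length = k + 1 := by simp [hx]
  have hly : (V y).length = j + 1 := by simp [hy]
  rcases hV.pour (l := []) hxy (by simpa using hx) (by simp) (Or.inr htop) hlty with
    ⟨h0, -⟩ | ⟨m, u, v, hm1, -, hmh, hor, hu, hv, hfu, hfv, hle⟩
  · exact h0 rfl
  · simp only [binPotential, if_neg hsx, if_neg hsy, hfu, hfv, hfx, hfy, if_true] at hle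
    split_ifs at hle <;> omega

/-- Either the top segment of the source bin can be poured away completely, or no other bin can
accept any of it. -/
lemma Consolidated.pour_source {h : ℕ} {x : B} {V : B → List C}
    (hV : Consolidated h (fun b => b = x) V) (hcfg : Config h V)
    {l : List C} {k : ℕ} {c : C}
    (hx : V x = l ++ List.replicate (k + 1) c) (hl : l.getLast? ≠ some c) :
    (∃ V', WaterMove h V V' ∧ V' x = l ∧ ∀ b, b ≠ x → frame (V' b) = frame (V b)) ∨
    ∀ y, y ≠ x → (V y = [] ∨ (V y).getLast? = some c) → (V y).length = h := by
  by_contra! hcon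
  obtain ⟨hno, y, hyx, hy, hne⟩ := hcon
  have hlt : (V y).length < h := lt_of_le_of_ne (hcfg y) hne
  rcases hV.pour hyx.symm hx hl hy hlt with
    ⟨-, V', hm, hx', hf⟩ | ⟨m, u, v, hm1, -, hmh, hor, hu, hv, hfu, hfv, hle⟩
  · obtain ⟨b, hb, hfb⟩ := hno V' hm hx'
    exact hfb (hf b hb)
  · simp only [binPotential, if_true, if_neg hyx, hfv] at hle
    split_ifs at hle <;> omega

end Consolidate

/-! ### Counting monochromatic bins -/

section Counting

variable {B C : Type*}

lemma sum_indicator_top_le [Fintype C] (E : Finset B) (V : B → List C) :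
    ∑ d : C, ∑ b ∈ E, (if (V b).getLast? = some d then 1 else 0) ≤ E.card := by
  rw [Finset.sum_comm, Finset.card_eq_sum_ones]
  refine Finset.sum_le_sum fun b _ => ?_
  cases hb : (V b).getLast? with
  | none => simp
  | some c => simp

lemma sum_indicator_top_eq [Fintype C] {E : Finset B} {V : B → List C}
    (hE : ∀ b ∈ E, V b ≠ []) :
    ∑ d : C, ∑ b ∈ E, (if (V b).getLast? = some d then 1 else 0) = E.card := by
  rw [Finset.sum_comm, Finset.card_eq_sum_ones]
  refine Finset.sum_congr rfl fun b hb => ?_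
  cases hb' : (V b).getLast? with
  | none => exact absurd (List.getLast?_eq_none_iff.mp hb') (hE b hb)
  | some c => simp

lemma sum_count_le_mul {h : ℕ} {E : Finset B} {S : B → List C} (hS : Config h S)
    (hE : ∀ b ∈ E, frame (S b) = none) (d : C) :
    ∑ b ∈ E, (S b).count d ≤ h * ∑ b ∈ E, (if (S b).getLast? = some d then 1 else 0) := by
  rw [Finset.mul_sum]
  refine Finset.sum_le_sum fun b hb => ?_
  rw [count_of_frame_eq_none (hE b hb)]
  have := hS b
  split_ifs <;> simp [this]

/-- If all but one monochromatic bins of color `d` are full, the number of bins is the least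
possible for their total content. -/
lemma mul_le_sum_count {h : ℕ} {E : Finset B} {V : B → List C}
    (hE : ∀ b ∈ E, frame (V b) = none) {x : B} (hxE : x ∈ E) {d : C}
    (hx : (V x).getLast? = some d)
    (hfull : ∀ b ∈ E, b ≠ x → (V b).getLast? = some d → (V b).length = h) :
    h * ∑ b ∈ E, (if (V b).getLast? = some d then 1 else 0) + 1 ≤
      ∑ b ∈ E, (V b).count d + h := by
  rw [← Finset.add_sum_erase _ _ hxE, ← Finset.add_sum_erase _ (fun b => (V b).count d) hxE,
    if_pos hx, mul_add, Finset.mul_sum]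
  have hrest : ∑ b ∈ E.erase x, h * (if (V b).getLast? = some d then 1 else 0) ≤
      ∑ b ∈ E.erase x, (V b).count d := Finset.sum_le_sum fun b hb => by
    obtain ⟨hbx, hbE⟩ := Finset.mem_erase.mp hb
    rw [count_of_frame_eq_none (hE b hbE)]
    split_ifs with ht
    · simp [hfull b hbE hbx ht]
    · simp
  have hpos : 1 ≤ (V x).count d := by
    rw [count_of_frame_eq_none (hE x hxE), if_pos hx]
    exact List.length_pos_iff.mpr (by rintro h0; simp [h0] at hx)
  omega

end Counting

/-! ### Simulating ball-moves by water-moves -/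

section Simulation

variable {B C : Type*} [Fintype B]

/-- If some configuration `S'` has the same color totals as a consolidated `V`, and the same frames
except that the top segment of `x` is gone, then `V` is not stuck at `x`. -/
lemma not_stuck [Fintype C] {h : ℕ} (hh : 1 ≤ h) {x : B} {V S' : B → List C}
    (hV : Consolidated h (fun b => b = x) V) (hcfg : Config h V) (hcfg' : Config h S')
    (hcount : ∀ d, ∑ b, (V b).count d = ∑ b, (S' b).count d)
    {k : ℕ} {c : C} (hx : V x = S' x ++ List.replicate (k + 1) c)
    (hfx : frame (V x) ≠ none) (hf : ∀ b, b ≠ x → frame (V b) = frame (S' b))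
    (hstuck : ∀ y, y ≠ x → (V y = [] ∨ (V y).getLast? = some c) → (V y).length = h) :
    False := by
  set E : Finset B := Finset.univ.filter (fun b => frame (V b) = none) with hEdef
  have hEx : ∀ b ∈ E, b ≠ x := fun b hb hbx => hfx (hbx ▸ (Finset.mem_filter.mp hb).2)
  have hE : ∀ b ∈ E, frame (V b) = none := fun b hb => (Finset.mem_filter.mp hb).2
  have hE' : ∀ b ∈ E, frame (S' b) = none := fun b hb => by rw [← hf b (hEx b hb), hE b hb]
  have hxE : x ∈ Eᶜ := by simp [hEdef, hfx]
  have hsplit : ∀ d, ∑ b ∈ E, (V b).count d + ∑ b ∈ Eᶜ, (V b).count d =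
      ∑ b ∈ E, (S' b).count d + ∑ b ∈ Eᶜ, (S' b).count d := fun d => by
    rw [Finset.sum_add_sum_compl, Finset.sum_add_sum_compl, hcount]
  have hoff : ∀ d, (∀ b ∈ Eᶜ, b ≠ x → (V b).getLast? = some d → (V b).length = h) →
      ∀ b ∈ Eᶜ, (S' b).count d ≤ (V b).count d := fun d hd b hb => by
    by_cases hbx : b = x
    · rw [hbx, hx, List.count_append]
      omega
    · exact count_le_count_of_frame_eq (hf b hbx) (by simpa [hEdef] using hb) (hd b hb hbx)
        (hcfg' b)
  have hc : ∑ b ∈ E, (if (V b).getLast? = some c then 1 else 0) <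
      ∑ b ∈ E, (if (S' b).getLast? = some c then 1 else 0) := by
    have h1 : ∑ b ∈ Eᶜ, (S' b).count c < ∑ b ∈ Eᶜ, (V b).count c :=
      Finset.sum_lt_sum (hoff c fun b _ hbx ht => hstuck b hbx (Or.inr ht))
        ⟨x, hxE, by rw [hx, List.count_append, List.count_replicate_self]; omega⟩
    have h2 := sum_count_le_mul hcfg' hE' c
    have h3 : h * ∑ b ∈ E, (if (V b).getLast? = some c then 1 else 0) ≤
        ∑ b ∈ E, (V b).count c := by
      rw [Finset.mul_sum]
      refine Finset.sum_le_sum fun b hb => ?_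
      rw [count_of_frame_eq_none (hE b hb)]
      split_ifs with ht
      · simp [hstuck b (hEx b hb) (Or.inr ht)]
      · simp
    have h4 := hsplit c
    exact lt_of_mul_lt_mul_left (a := h) (by omega) (Nat.zero_le _)
  have hd : ∀ d, ∑ b ∈ E, (if (V b).getLast? = some d then 1 else 0) ≤
      ∑ b ∈ E, (if (S' b).getLast? = some d then 1 else 0) := fun d => by
    by_cases hnone : ∀ b ∈ E, (V b).getLast? ≠ some d
    · rw [Finset.sum_eq_zero fun b hb => if_neg (hnone b hb)]
      exact Nat.zero_le _
    push Not at hnone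
    obtain ⟨z₀, hz₀, ht₀⟩ := hnone
    obtain ⟨z, hzE, hzt, hz⟩ : ∃ z ∈ E, (V z).getLast? = some d ∧
        ∀ b ∈ E, b ≠ z → (V b).getLast? = some d → (V b).length = h := by
      by_cases hall : ∀ b ∈ E, (V b).getLast? = some d → (V b).length = h
      · exact ⟨z₀, hz₀, ht₀, fun b hb _ => hall b hb⟩
      push Not at hall
      obtain ⟨z, hzE, hzt, hzne⟩ := hall
      refine ⟨z, hzE, hzt, fun b hb hbz hbt => ?_⟩
      obtain ⟨i, hi⟩ := eq_replicate_of_frame_eq_none (hE z hzE) hzt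
      obtain ⟨j, hj⟩ := eq_replicate_of_frame_eq_none (hE b hb) hbt
      exact (hV.full_or_full hcfg hbz (hEx b hb) (hEx z hzE) hj hi).resolve_right hzne
    obtain ⟨i, hi⟩ := eq_replicate_of_frame_eq_none (hE z hzE) hzt
    have h1 : ∑ b ∈ Eᶜ, (S' b).count d ≤ ∑ b ∈ Eᶜ, (V b).count d :=
      Finset.sum_le_sum (hoff d fun b hb hbx ht =>
        hV.full_of_frame_ne_none hcfg (hEx z hzE) hbx hi (by simpa [hEdef] using hb) ht)
    have h2 := sum_count_le_mul hcfg' hE' d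
    have h3 := mul_le_sum_count hE hzE hzt hz
    have h4 := hsplit d
    refine Nat.lt_succ_iff.mp (lt_of_mul_lt_mul_left (a := h) ?_ (Nat.zero_le _))
    rw [Nat.mul_succ]
    omega
  have hlt := Finset.sum_lt_sum (s := Finset.univ) (fun d _ => hd d) ⟨c, Finset.mem_univ _, hc⟩
  rw [sum_indicator_top_eq] at hlt
  · exact absurd (sum_indicator_top_le E S') (not_le.mpr hlt)
  · intro b hb h0
    have := hstuck b (hEx b hb) (Or.inl h0)
    simp [h0] at this
    omega

/-- Water-moves can follow the frames along a ball-move. -/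
lemma BallMove.simulate [Fintype C] {h : ℕ} (hh : 1 ≤ h) {S S' W : B → List C}
    (hm : BallMove h S S') (hS : Config h S) (hW : Config h W)
    (hcount : ∀ d, ∑ b, (W b).count d = ∑ b, (S b).count d)
    (hf : ∀ b, frame (W b) = frame (S b)) :
    ∃ W', ReflTransGen (WaterMove h) W W' ∧ ∀ b, frame (W' b) = frame (S' b) := by
  have hS' := hm.config hS
  have hcount' : ∀ d, ∑ b, (W b).count d = ∑ b, (S' b).count d := fun d =>
    (hcount d).trans (hm.sum_count d).symm
  obtain ⟨x, y, c, hxy, h1, h2, h3, -, h5⟩ := hm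
  have hfb : ∀ b, b ≠ x → frame (S' b) = frame (S b) := fun b hb => by
    by_cases hby : b = y
    · rw [hby, h3]
      exact frame_append_replicate_of_top h2 1
    · rw [h5 b hb hby]
  by_cases htop : S' x = [] ∨ (S' x).getLast? = some c
  · refine ⟨W, .refl, fun b => (hf b).trans ?_⟩
    by_cases hb : b = x
    · rw [hb, h1]
      exact frame_append_replicate_of_top htop 1
    · exact (hfb b hb).symm
  push Not at htop
  have hfx : frame (S x) = some (S' x, c) := by
    rw [h1]
    exact frame_append_replicate htop.1 htop.2 0
  obtain ⟨V, hr, hfV, hV⟩ := exists_consolidated h (fun b => b = x) W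
  obtain ⟨hcfgV, hcountV⟩ := ballMoves_invariant hW (ballMoves_of_waterMoves hr)
  have hfVx : frame (V x) = some (S' x, c) := by rw [hfV, hf, hfx]
  obtain ⟨-, -, k, hk⟩ := eq_of_frame_eq_some hfVx
  rcases hV.pour_source hcfgV hk htop.2 with ⟨V', hmV, hx', hf'⟩ | hstuck
  · refine ⟨V', hr.tail hmV, fun b => ?_⟩
    by_cases hb : b = x
    · rw [hb, hx']
    · rw [hf' b hb, hfV, hf, hfb b hb]
  · exact (not_stuck hh hV hcfgV hS' (fun d => (hcountV d).trans (hcount' d)) hk (by simp [hfVx])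
      (fun b hb => by rw [hfV, hf, hfb b hb]) hstuck).elim

lemma exists_waterMoves_frame_eq [Fintype C] {h : ℕ} (hh : 1 ≤ h) {S T : B → List C}
    (hS : Config h S) (hr : ReflTransGen (BallMove h) S T) :
    ∃ W, ReflTransGen (WaterMove h) S W ∧ ∀ b, frame (W b) = frame (T b) := by
  induction hr with
  | refl => exact ⟨S, .refl, fun _ => rfl⟩
  | tail hr hm ih =>
    obtain ⟨W, hrW, hf⟩ := ih
    obtain ⟨hcfg, hcount⟩ := ballMoves_invariant hS hr
    obtain ⟨hcfgW, hcountW⟩ := ballMoves_invariant hS (ballMoves_of_waterMoves hrW)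
    obtain ⟨W', hrW', hf'⟩ := hm.simulate hh hcfg hcfgW
      (fun d => (hcountW d).trans (hcount d).symm) hf
    exact ⟨W', hrW.trans hrW', hf'⟩

/-- A consolidated configuration of monochromatic bins is sorted, provided the amount of each
color is a multiple of `h`. -/
lemma Consolidated.sortedConfig {h : ℕ} {V : B → List C}
    (hV : Consolidated h (fun _ => False) V) (hcfg : Config h V)
    (hmono : ∀ b, frame (V b) = none) (hdvd : ∀ d, h ∣ ∑ b, (V b).count d) :
    SortedConfig h V := by
  intro x
  rcases eq_of_frame_eq_none (hmono x) with h0 | ⟨k, d, hx⟩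
  · exact Or.inl h0
  right
  refine ⟨d, ?_⟩
  have hlen : (V x).length = k + 1 := by simp [hx]
  suffices hfull : (V x).length = h by rw [hx, ← hlen, hfull]
  by_contra hne
  have hothers : ∀ b ∈ Finset.univ.erase x, h ∣ (V b).count d := fun b hb => by
    rw [count_of_frame_eq_none (hmono b)]
    split_ifs with ht
    · obtain ⟨j, hj⟩ := eq_replicate_of_frame_eq_none (hmono b) ht
      rw [(hV.full_or_full hcfg (Finset.ne_of_mem_erase hb) id id hj hx).resolve_right hne]
    · exact dvd_zero h
  have hsum := hdvd d
  rw [← Finset.add_sum_erase _ _ (Finset.mem_univ x)] at hsum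
  have hdx : h ∣ (V x).count d := (Nat.dvd_add_left (Finset.dvd_sum hothers)).mp hsum
  rw [hx, List.count_replicate_self] at hdx
  have := Nat.le_of_dvd (Nat.succ_pos k) hdx
  have := hcfg x
  omega

end Simulation

/-- an initial configuration is sortable by ball-moves iff it is sortable by
water-moves. -/
theorem statement_7 {B C : Type*} [Fintype B] [Fintype C] (h : ℕ) (hh : 1 ≤ h)
    (S₀ : B → List C) (hInit : InitConfig h S₀) :
    (∃ T : B → List C, SortedConfig h T ∧ Relation.ReflTransGen (BallMove h) S₀ T) ↔
    (∃ T : B → List C, SortedConfig h T ∧ Relation.ReflTransGen (WaterMove h) S₀ T) := by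
  refine ⟨?_, fun ⟨T, hT, hr⟩ => ⟨T, hT, ballMoves_of_waterMoves hr⟩⟩
  rintro ⟨T, hT, hr⟩
  have hS₀ : Config h S₀ := fun b => by rcases hInit b with hb | hb <;> omega
  obtain ⟨W, hrW, hfW⟩ := exists_waterMoves_frame_eq hh hS₀ hr
  obtain ⟨V, hrV, hfV, hV⟩ := exists_consolidated h (fun _ => False) W
  have hrSV := hrW.trans hrV
  obtain ⟨hcfgV, hcountV⟩ := ballMoves_invariant hS₀ (ballMoves_of_waterMoves hrSV)
  refine ⟨V, hV.sortedConfig hcfgV (fun b => ?_) (fun d => ?_), hrSV⟩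
  · rw [hfV, hfW]
    rcases hT b with hb | ⟨c, hb⟩
    · rw [hb, frame_nil]
    · rw [hb, frame_replicate]
  · rw [hcountV d, ← (ballMoves_invariant hS₀ hr).2 d]
    refine Finset.dvd_sum fun b _ => ?_
    rcases hT b with hb | ⟨c, hb⟩
    · simp [hb]
    · rw [hb, List.count_replicate]
      split_ifs <;> simp
end
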